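/- Let G be a group with identity element 1, m ∈ G, and L a subgroup of G. Let Q denote the quotient of the unitization R_m(1) by the two-sided ideal generated by the sets {[lx] − [x] : x ∈ G, l ∈ L}, {[xl] − [x] : x ∈ G, l ∈ L} and {[mx] − [xm] : x ∈ G}, with quotient map π : R_m(1) → Q. Then there is a ring isomorphism from the cord algebra A_Ng(G,m,L) to Q carrying the class of the generator [x] to π([x]) for every x ∈ G, and carrying μ·1 to π(𝔢 − 1) and μ⁻¹·1 to π(𝔪̄ − 1). -/

import Mathlib

noncomputable section

/-- The underlying additive group of the group ring `ℤ[G]`, equipped below with the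
*twisted* (non-unital) product `u *̃ v = u · ([1] + [m]) · v`. -/
@[ext]
structure Rm (G : Type) [Group G] (m : G) : Type where
  val : MonoidAlgebra ℤ G

namespace Rm

variable {G : Type} [Group G] {m : G}

/-- The twisting element `[1] + [m]` of the group ring `ℤ[G]`. -/
def tw (G : Type) [Group G] (m : G) : MonoidAlgebra ℤ G :=
  MonoidAlgebra.single 1 1 + MonoidAlgebra.single m 1

theorem val_injective : Function.Injective (val : Rm G m → MonoidAlgebra ℤ G) := by
  intro a b h; cases a; cases b; cases h; rfl

instance : Zero (Rm G m) := ⟨⟨0⟩⟩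
instance : Add (Rm G m) := ⟨fun a b => ⟨a.val + b.val⟩⟩
instance : Neg (Rm G m) := ⟨fun a => ⟨-a.val⟩⟩
instance : Sub (Rm G m) := ⟨fun a b => ⟨a.val - b.val⟩⟩
instance : SMul ℕ (Rm G m) := ⟨fun n a => ⟨n • a.val⟩⟩
instance : SMul ℤ (Rm G m) := ⟨fun n a => ⟨n • a.val⟩⟩

/-- The twisted product `u *̃ v = u · ([1] + [m]) · v`. -/
instance : Mul (Rm G m) := ⟨fun a b => ⟨a.val * tw G m * b.val⟩⟩

@[simp] theorem zero_val : (0 : Rm G m).val = 0 := rfl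
@[simp] theorem add_val (a b : Rm G m) : (a + b).val = a.val + b.val := rfl
@[simp] theorem neg_val (a : Rm G m) : (-a).val = -a.val := rfl
@[simp] theorem sub_val (a b : Rm G m) : (a - b).val = a.val - b.val := rfl
@[simp] theorem nsmul_val (n : ℕ) (a : Rm G m) : (n • a).val = n • a.val := rfl
@[simp] theorem zsmul_val (n : ℤ) (a : Rm G m) : (n • a).val = n • a.val := rfl
@[simp] theorem mul_val (a b : Rm G m) : (a * b).val = a.val * tw G m * b.val := rfl

instance : AddCommGroup (Rm G m) :=
  val_injective.addCommGroup val rfl (fun _ _ => rfl) (fun _ => rfl) (fun _ _ => rfl)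
    (fun _ _ => rfl) (fun _ _ => rfl)

instance : NonUnitalRing (Rm G m) :=
  { (inferInstance : AddCommGroup (Rm G m)), (inferInstance : Mul (Rm G m)) with
    left_distrib := fun a b c => val_injective (by simp [mul_add])
    right_distrib := fun a b c => val_injective (by simp [add_mul])
    zero_mul := fun a => val_injective (by simp)
    mul_zero := fun a => val_injective (by simp)
    mul_assoc := fun a b c => val_injective (by simp [mul_assoc]) }

instance : Module ℤ (Rm G m) :=
  Function.Injective.module ℤ
    { toFun := val, map_zero' := rfl, map_add' := fun _ _ => rfl }
    val_injective (fun _ _ => rfl)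

instance : SMulCommClass ℤ (Rm G m) (Rm G m) :=
  ⟨fun z a b => val_injective (by simp [mul_smul_comm])⟩

instance : IsScalarTower ℤ (Rm G m) (Rm G m) :=
  ⟨fun z a b => val_injective (by simp [smul_mul_assoc])⟩

end Rm

/-- The basis element `[x]` of `ℤ[G]`, viewed inside the twisted ring `R_m`. -/
def el {G : Type} [Group G] (m x : G) : Rm G m := ⟨MonoidAlgebra.single x 1⟩

/-- The basis element `[x]` of `ℤ[G]`, viewed inside the unitization `R_m(1) = ℤ ⊕ R_m`. -/
def br {G : Type} [Group G] (m x : G) : Unitization ℤ (Rm G m) :=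
  Unitization.inr (el m x)

/-- The generators of the ideal defining the string algebra presentation:
`[lx] - [x]`, `[xl] - [x]` (for `l ∈ L`), and `[mx] - [xm]`, inside `R_m(1)`. -/
def stringRelSet (G : Type) [Group G] (m : G) (L : Subgroup G) :
    Set (Unitization ℤ (Rm G m)) :=
  {z | ∃ x : G, ∃ l ∈ L, z = br m (l * x) - br m x} ∪
    {z | ∃ x : G, ∃ l ∈ L, z = br m (x * l) - br m x} ∪
    {z | ∃ x : G, z = br m (m * x) - br m (x * m)}

/-- The quotient `Q` of `R_m(1)` by the two-sided ideal generated by `stringRelSet`. -/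
abbrev StringQuot (G : Type) [Group G] (m : G) (L : Subgroup G) :=
  (TwoSidedIdeal.span (stringRelSet G m L)).ringCon.Quotient

/-- The quotient map `π : R_m(1) → Q`. -/
def stringQuotMap (G : Type) [Group G] (m : G) (L : Subgroup G) :
    Unitization ℤ (Rm G m) →+* StringQuot G m L :=
  RingCon.mk' _

open LaurentPolynomial

/-- The generators of the two-sided ideal of relations (4), (5), (6) in the free unital
associative `ℤ[μ^{±1}]`-algebra `T(V_μ)` on the set `G`. -/
def relASetMu (G : Type) [Group G] (m : G) (L : Subgroup G) :
    Set (FreeAlgebra (LaurentPolynomial ℤ) G) :=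
  {z | ∃ x y : G, z = FreeAlgebra.ι _ (x * y) + FreeAlgebra.ι _ (x * m * y)
      - FreeAlgebra.ι _ x * FreeAlgebra.ι _ y} ∪
    {z | ∃ x : G, ∃ l ∈ L, z = FreeAlgebra.ι _ (l * x) - FreeAlgebra.ι _ x} ∪
    {z | ∃ x : G, ∃ l ∈ L, z = FreeAlgebra.ι _ (x * l) - FreeAlgebra.ι _ x} ∪
    {z | ∃ x : G, z = FreeAlgebra.ι _ (m * x) - FreeAlgebra.ι _ (x * m)} ∪
    {z | ∃ x : G, z = FreeAlgebra.ι _ (m⁻¹ * x) - FreeAlgebra.ι _ (x * m⁻¹)}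

/-- The generator of the ideal of relation (7): `[1] - (1 + μ)`, in `T(V_μ)`. -/
def rel7SetMu' (G : Type) [Group G] : Set (FreeAlgebra (LaurentPolynomial ℤ) G) :=
  {z | z = FreeAlgebra.ι _ (1 : G)
      - (1 + algebraMap (LaurentPolynomial ℤ) (FreeAlgebra (LaurentPolynomial ℤ) G) (T 1))}

/-- The generators of the ideal of relation (8): `[mx] - μ[x]` and `[m⁻¹x] - μ⁻¹[x]`,
in `T(V_μ)`. -/
def rel8SetMu (G : Type) [Group G] (m : G) : Set (FreeAlgebra (LaurentPolynomial ℤ) G) :=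
  {z | ∃ x : G, z = FreeAlgebra.ι _ (m * x)
      - algebraMap (LaurentPolynomial ℤ) (FreeAlgebra (LaurentPolynomial ℤ) G) (T 1)
          * FreeAlgebra.ι _ x} ∪
    {z | ∃ x : G, z = FreeAlgebra.ι _ (m⁻¹ * x)
      - algebraMap (LaurentPolynomial ℤ) (FreeAlgebra (LaurentPolynomial ℤ) G) (T (-1))
          * FreeAlgebra.ι _ x}

/-- Ng's cord algebra `A_Ng(G,m,L)`: the quotient of `T(V_μ)` by the two-sided ideal
generated by relations (4)–(8). -/
abbrev CordAlg (G : Type) [Group G] (m : G) (L : Subgroup G) :=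
  (TwoSidedIdeal.span (relASetMu G m L ∪ rel7SetMu' G ∪ rel8SetMu G m)).ringCon.Quotient

/-- The quotient map `T(V_μ) → A_Ng(G,m,L)`. -/
def cordAlgMap (G : Type) [Group G] (m : G) (L : Subgroup G) :
    FreeAlgebra (LaurentPolynomial ℤ) G →+* CordAlg G m L :=
  RingCon.mk' _

/-- A ring homomorphism vanishing on `s` is constant on the classes modulo `span s`. -/
theorem TwoSidedIdeal.ringCon_span_le_ker {R P : Type*} [Ring R] [Ring P] {s : Set R}
    (f : R →+* P) (h : ∀ z ∈ s, f z = 0) :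
    (TwoSidedIdeal.span s).ringCon ≤ RingCon.ker f := by
  have hs : TwoSidedIdeal.span s ≤ TwoSidedIdeal.ker f :=
    TwoSidedIdeal.span_le.2 fun z hz => (TwoSidedIdeal.mem_ker f).2 (h z hz)
  exact TwoSidedIdeal.ringCon_le_iff.1 hs

/-- The class of an element of the generating set of a two-sided ideal is zero. -/
theorem TwoSidedIdeal.mk'_span_eq_zero {R : Type*} [Ring R] {s : Set R} {z : R} (hz : z ∈ s) :
    (TwoSidedIdeal.span s).ringCon.mk' z = 0 :=
  (RingCon.eq _).2 ((TwoSidedIdeal.mem_iff _ _).1 (TwoSidedIdeal.subset_span hz))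

section Laurent

variable {A : Type*} [Ring A]

/-- The ring homomorphism `ℤ[T;T⁻¹] → A` sending `T` to a given unit. -/
def laurentLift (u : Aˣ) : LaurentPolynomial ℤ →+* A :=
  AddMonoidAlgebra.liftNCRingHom (Int.castRingHom A)
    ((Units.coeHom A).comp (zpowersHom Aˣ u)) fun n _ => Int.cast_commute n _

theorem laurentLift_T (u : Aˣ) (n : ℤ) : laurentLift u (T n) = ((u ^ n : Aˣ) : A) := by
  refine (AddMonoidAlgebra.liftNC_single _ _ n 1).trans ?_
  simp

theorem laurentLift_commute {u : Aˣ} (hu : ∀ a : A, Commute (u : A) a)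
    (p : LaurentPolynomial ℤ) (a : A) : Commute (laurentLift u p) a := by
  induction p using LaurentPolynomial.induction_on' with
  | add p q hp hq => rw [map_add]; exact hp.add_left hq
  | C_mul_T n c =>
    rw [map_mul, laurentLift_T, eq_intCast (C : ℤ →+* LaurentPolynomial ℤ), map_intCast]
    refine (Int.cast_commute c a).mul_left ?_
    exact ((hu a).symm.units_zpow_right n).symm

/-- A family of elements of a ring together with a central unit extends to a ring homomorphism
from the free algebra over the Laurent polynomials. -/
theorem exists_freeAlgebra_laurent_hom {X : Type*} (f : X → A) {u : Aˣ}
    (hu : ∀ a : A, Commute (u : A) a) :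
    ∃ g : FreeAlgebra (LaurentPolynomial ℤ) X →+* A,
      (∀ x, g (FreeAlgebra.ι _ x) = f x) ∧
        ∀ n : ℤ, g (algebraMap (LaurentPolynomial ℤ) _ (T n)) = ((u ^ n : Aˣ) : A) := by
  let _ : Algebra (LaurentPolynomial ℤ) A := (laurentLift u).toAlgebra' (laurentLift_commute hu)
  refine ⟨(FreeAlgebra.lift (LaurentPolynomial ℤ) f : FreeAlgebra _ X →ₐ[_] A),
    fun x => FreeAlgebra.lift_ι_apply f x, fun n => ?_⟩
  exact ((FreeAlgebra.lift (LaurentPolynomial ℤ) f).commutes _).trans (laurentLift_T u n)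

theorem freeAlgebra_laurent_hom_ext {X : Type*}
    {g g' : FreeAlgebra (LaurentPolynomial ℤ) X →+* A}
    (hι : ∀ x, g (FreeAlgebra.ι _ x) = g' (FreeAlgebra.ι _ x))
    (hT : g (algebraMap (LaurentPolynomial ℤ) _ (T 1)) =
      g' (algebraMap (LaurentPolynomial ℤ) _ (T 1)))
    (hT' : g (algebraMap (LaurentPolynomial ℤ) _ (T (-1))) =
      g' (algebraMap (LaurentPolynomial ℤ) _ (T (-1)))) : g = g' := by
  ext a
  induction a using FreeAlgebra.induction with
  | grade0 r =>
    induction r using LaurentPolynomial.induction_on with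
    | h_C c => rw [eq_intCast (C : ℤ →+* LaurentPolynomial ℤ)]; simp
    | h_add hp hq => simp only [map_add, hp, hq]
    | h_C_mul_T n c h => rw [T_add, ← mul_assoc, map_mul _ _ (T 1), map_mul g, map_mul g', h, hT]
    | h_C_mul_T_Z n c h => rw [T_sub, ← mul_assoc, map_mul _ _ (T (-1)), map_mul g, map_mul g', h, hT']
  | grade1 x => exact hι x
  | mul a b ha hb => rw [map_mul, map_mul, ha, hb]
  | add a b ha hb => rw [map_add, map_add, ha, hb]

end Laurent

section Unitization

variable {G : Type} [Group G] {m : G} {A : Type*} [Ring A]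

theorem el_mul_el (x y : G) : el m x * el m y = el m (x * y) + el m (x * m * y) := by
  ext1
  simp [el, Rm.tw, mul_add, add_mul, MonoidAlgebra.single_mul_single]

theorem br_mul_br (x y : G) : br m x * br m y = br m (x * y) + br m (x * m * y) := by
  simp only [br, ← Unitization.inr_mul, ← Unitization.inr_add, el_mul_el]

@[elab_as_elim]
theorem Rm.induction_el {p : Rm G m → Prop} (u : Rm G m) (hel : ∀ x, p (el m x))
    (hadd : ∀ u v, p u → p v → p (u + v)) (hsmul : ∀ (n : ℤ) u, p u → p (n • u)) : p u := by
  obtain ⟨u⟩ := u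
  induction u using MonoidAlgebra.induction_on with
  | of x => exact hel x
  | add a b ha hb => exact hadd _ _ ha hb
  | smul n a ha => exact hsmul n _ ha

theorem unitization_rm_hom_ext {g g' : Unitization ℤ (Rm G m) →+* A}
    (h : ∀ x, g (br m x) = g' (br m x)) : g = g' := by
  ext z
  induction z with
  | inl_add_inr n u =>
    have hn (n : ℤ) : (Unitization.inl n : Unitization ℤ (Rm G m)) = n :=
      map_intCast (Unitization.inlRingHom ℤ (Rm G m)) n
    rw [map_add, map_add, hn, map_intCast, map_intCast]
    congr 1
    induction u using Rm.induction_el with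
    | hel x => exact h x
    | hadd u v hu hv => rw [Unitization.inr_add, map_add, map_add, hu, hv]
    | hsmul n u hu =>
      have : ((n • u : Rm G m) : Unitization ℤ (Rm G m)) =
          n * (u : Unitization ℤ (Rm G m)) := by
        rw [← hn, Unitization.inl_mul_inr]
      rw [this, map_mul, map_mul, hu, map_intCast, map_intCast]

/-- The additive map `R_m → A` extending a function on the group. -/
def rmLiftAdd (m : G) (f : G → A) : Rm G m →+ A :=
  (MonoidAlgebra.liftNC (Int.castAddHom A) f).comp
    { toFun := Rm.val, map_zero' := rfl, map_add' := fun _ _ => rfl }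

theorem rmLiftAdd_el (f : G → A) (x : G) : rmLiftAdd m f (el m x) = f x := by
  simp [rmLiftAdd, el]

theorem rmLiftAdd_mul {f : G → A} (hf : ∀ x y, f (x * y) + f (x * m * y) = f x * f y)
    (u v : Rm G m) : rmLiftAdd m f (u * v) = rmLiftAdd m f u * rmLiftAdd m f v := by
  induction u using Rm.induction_el with
  | hel x =>
    induction v using Rm.induction_el with
    | hel y => rw [el_mul_el, map_add]; simp only [rmLiftAdd_el, hf]
    | hadd u v hu hv => rw [mul_add, map_add, map_add, mul_add, hu, hv]
    | hsmul n u hu =>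
      rw [mul_smul_comm]
      exact (map_zsmul _ _ _).trans <| (congrArg _ hu).trans <|
        (mul_smul_comm _ _ _).symm.trans (congrArg _ (map_zsmul _ _ _).symm)
  | hadd u w hu hw => rw [add_mul, map_add, map_add, add_mul, hu, hw]
  | hsmul n u hu =>
    rw [smul_mul_assoc]
    exact (map_zsmul _ _ _).trans <| (congrArg _ hu).trans <|
      (smul_mul_assoc _ _ _).symm.trans (congrArg (· * _) (map_zsmul _ _ _).symm)

/-- A function on `G` compatible with the twisted product extends to `R_m(1)`. -/
theorem exists_unitization_rm_hom {f : G → A}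
    (hf : ∀ x y, f (x * y) + f (x * m * y) = f x * f y) :
    ∃ g : Unitization ℤ (Rm G m) →+* A, ∀ x, g (br m x) = f x := by
  let φ : Rm G m →ₙₐ[ℤ] A :=
    { rmLiftAdd m f with
      map_smul' := fun n u => map_zsmul (rmLiftAdd m f) n u
      map_zero' := map_zero _
      map_mul' := rmLiftAdd_mul hf }
  refine ⟨(Unitization.lift φ : Unitization ℤ (Rm G m) →ₐ[ℤ] A), fun x => ?_⟩
  exact (DFunLike.congr_fun (Unitization.lift.symm_apply_apply φ) (el m x)).trans
    (rmLiftAdd_el f x)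

end Unitization

section StringQuot

variable {G : Type} [Group G] {m : G} {L : Subgroup G}

/-- The class of `[x]` in `Q`. -/
def stringCl (m : G) (L : Subgroup G) (x : G) : StringQuot G m L := stringQuotMap G m L (br m x)

theorem stringCl_mul (x y : G) :
    stringCl m L (x * y) + stringCl m L (x * m * y) = stringCl m L x * stringCl m L y := by
  simp only [stringCl, ← map_mul, br_mul_br, map_add]

theorem stringQuotMap_eq_of_sub_mem {a b : Unitization ℤ (Rm G m)}
    (h : a - b ∈ stringRelSet G m L) : stringQuotMap G m L a = stringQuotMap G m L b := by
  rw [← sub_eq_zero, ← map_sub]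
  exact TwoSidedIdeal.mk'_span_eq_zero h

theorem stringCl_left (x : G) {l : G} (hl : l ∈ L) : stringCl m L (l * x) = stringCl m L x :=
  stringQuotMap_eq_of_sub_mem (.inl (.inl ⟨x, l, hl, rfl⟩))

theorem stringCl_right (x : G) {l : G} (hl : l ∈ L) : stringCl m L (x * l) = stringCl m L x :=
  stringQuotMap_eq_of_sub_mem (.inl (.inr ⟨x, l, hl, rfl⟩))

theorem stringCl_comm (x : G) : stringCl m L (m * x) = stringCl m L (x * m) :=
  stringQuotMap_eq_of_sub_mem (.inr ⟨x, rfl⟩)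

theorem stringCl_comm_inv (x : G) : stringCl m L (m⁻¹ * x) = stringCl m L (x * m⁻¹) := by
  simpa [← mul_assoc] using (stringCl_comm (L := L) (m := m) (m⁻¹ * x * m⁻¹)).symm

theorem stringCl_one_sub_mul (x : G) :
    (stringCl m L 1 - 1) * stringCl m L x = stringCl m L (m * x) := by
  rw [sub_mul, ← stringCl_mul]; simp

theorem stringCl_mul_one_sub (x : G) :
    stringCl m L x * (stringCl m L 1 - 1) = stringCl m L (x * m) := by
  rw [mul_sub, ← stringCl_mul]; simp

theorem stringCl_inv_sub_mul (x : G) :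
    (stringCl m L m⁻¹ - 1) * stringCl m L x = stringCl m L (m⁻¹ * x) := by
  rw [sub_mul, ← stringCl_mul]; simp

theorem stringCl_mul_inv_sub (x : G) :
    stringCl m L x * (stringCl m L m⁻¹ - 1) = stringCl m L (x * m⁻¹) := by
  rw [mul_sub, ← stringCl_mul]; simp

/-- The unit `π(𝔢 - 1)` of `Q`, with inverse `π(𝔪̄ - 1)`. -/
def stringUnit (m : G) (L : Subgroup G) : (StringQuot G m L)ˣ where
  val := stringCl m L 1 - 1
  inv := stringCl m L m⁻¹ - 1
  val_inv := by rw [mul_sub, stringCl_one_sub_mul]; simp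
  inv_val := by rw [mul_sub, stringCl_inv_sub_mul]; simp

/-- Ring homomorphisms out of `Q` are determined by the classes `[x]`. -/
theorem stringQuot_hom_ext {A : Type*} [Ring A] {g g' : StringQuot G m L →+* A}
    (h : ∀ x, g (stringCl m L x) = g' (stringCl m L x)) : g = g' :=
  RingCon.Quotient.hom_ext (unitization_rm_hom_ext h)

theorem stringUnit_commute (a : StringQuot G m L) :
    Commute (stringUnit m L : StringQuot G m L) a := by
  have key : MulSemiringAction.toRingHom (ConjAct (StringQuot G m L)ˣ) (StringQuot G m L)
      (ConjAct.toConjAct (stringUnit m L)) = RingHom.id _ := by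
    refine stringQuot_hom_ext fun x => ?_
    have h : (stringUnit m L : StringQuot G m L) * stringCl m L x =
        stringCl m L x * (stringUnit m L : StringQuot G m L) :=
      (stringCl_one_sub_mul x).trans ((stringCl_comm x).trans (stringCl_mul_one_sub x).symm)
    simp [ConjAct.units_smul_def, h]
  have h := RingHom.congr_fun key a
  simp only [MulSemiringAction.toRingHom_apply, ConjAct.units_smul_def, ConjAct.ofConjAct_toConjAct,
    RingHom.id_apply] at h
  exact (Units.mul_inv_eq_iff_eq_mul _).1 h

/-- The homomorphism from the cord algebra to `Q`. -/
theorem exists_cordAlg_to_stringQuot (m : G) (L : Subgroup G) :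
    ∃ f : CordAlg G m L →+* StringQuot G m L,
      (∀ x, f (cordAlgMap G m L (FreeAlgebra.ι _ x)) = stringCl m L x) ∧
        f (cordAlgMap G m L (algebraMap (LaurentPolynomial ℤ) _ (T 1))) = stringCl m L 1 - 1 ∧
        f (cordAlgMap G m L (algebraMap (LaurentPolynomial ℤ) _ (T (-1)))) =
          stringCl m L m⁻¹ - 1 := by
  obtain ⟨g, hι, hT⟩ := exists_freeAlgebra_laurent_hom (stringCl m L) (stringUnit_commute (m := m))
  have hT₁ : g (algebraMap (LaurentPolynomial ℤ) _ (T 1)) = stringCl m L 1 - 1 := by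
    rw [hT, zpow_one]; rfl
  have hT₂ : g (algebraMap (LaurentPolynomial ℤ) _ (T (-1))) = stringCl m L m⁻¹ - 1 := by
    rw [hT, zpow_neg_one]; rfl
  refine ⟨RingCon.lift _ g (TwoSidedIdeal.ringCon_span_le_ker g ?_), hι, hT₁, hT₂⟩
  rintro z ((((((⟨x, y, rfl⟩ | ⟨x, l, hl, rfl⟩) | ⟨x, l, hl, rfl⟩) | ⟨x, rfl⟩) | ⟨x, rfl⟩) | rfl) |
    (⟨x, rfl⟩ | ⟨x, rfl⟩)) <;>
    simp only [map_sub, map_add, map_mul, map_one, hι, hT₁, hT₂, sub_eq_zero]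
  · exact stringCl_mul x y
  · exact stringCl_left x hl
  · exact stringCl_right x hl
  · exact stringCl_comm x
  · exact stringCl_comm_inv x
  · exact (add_sub_cancel _ _).symm
  · exact (stringCl_one_sub_mul x).symm
  · exact (stringCl_inv_sub_mul x).symm

end StringQuot

section CordAlg

variable {G : Type} [Group G] {m : G} {L : Subgroup G}

/-- The class of the generator `[x]` in the cord algebra. -/
def cordCl (m : G) (L : Subgroup G) (x : G) : CordAlg G m L :=
  cordAlgMap G m L (FreeAlgebra.ι _ x)

theorem cordAlgMap_eq_of_sub_mem {a b : FreeAlgebra (LaurentPolynomial ℤ) G}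
    (h : a - b ∈ relASetMu G m L ∪ rel7SetMu' G ∪ rel8SetMu G m) :
    cordAlgMap G m L a = cordAlgMap G m L b := by
  rw [← sub_eq_zero, ← map_sub]
  exact TwoSidedIdeal.mk'_span_eq_zero h

theorem cordCl_mul (x y : G) :
    cordCl m L (x * y) + cordCl m L (x * m * y) = cordCl m L x * cordCl m L y := by
  simp only [cordCl, ← map_add, ← map_mul]
  exact cordAlgMap_eq_of_sub_mem (.inl (.inl (.inl (.inl (.inl (.inl ⟨x, y, rfl⟩))))))

theorem cordCl_left (x : G) {l : G} (hl : l ∈ L) : cordCl m L (l * x) = cordCl m L x :=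
  cordAlgMap_eq_of_sub_mem (.inl (.inl (.inl (.inl (.inl (.inr ⟨x, l, hl, rfl⟩))))))

theorem cordCl_right (x : G) {l : G} (hl : l ∈ L) : cordCl m L (x * l) = cordCl m L x :=
  cordAlgMap_eq_of_sub_mem (.inl (.inl (.inl (.inl (.inr ⟨x, l, hl, rfl⟩)))))

theorem cordCl_comm (x : G) : cordCl m L (m * x) = cordCl m L (x * m) :=
  cordAlgMap_eq_of_sub_mem (.inl (.inl (.inl (.inr ⟨x, rfl⟩))))

theorem cordCl_one : cordCl m L 1 =
    1 + cordAlgMap G m L (algebraMap (LaurentPolynomial ℤ) _ (T 1)) := by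
  rw [← map_one (cordAlgMap G m L), ← map_add]
  exact cordAlgMap_eq_of_sub_mem (.inl (.inr rfl))

/-- `μ⁻¹ = [m⁻¹] - 1` in the cord algebra. -/
theorem cordCl_inv : cordCl m L m⁻¹ =
    1 + cordAlgMap G m L (algebraMap (LaurentPolynomial ℤ) _ (T (-1))) := by
  have h : cordCl m L (m⁻¹ * 1) =
      cordAlgMap G m L (algebraMap (LaurentPolynomial ℤ) _ (T (-1))) * cordCl m L 1 := by
    rw [cordCl, cordCl, ← map_mul]
    exact cordAlgMap_eq_of_sub_mem (.inr (.inr ⟨1, rfl⟩))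
  rw [mul_one, cordCl_one, mul_add, mul_one, ← map_mul, ← map_mul, ← T_add] at h
  simpa [add_comm] using h

/-- The homomorphism from `Q` to the cord algebra. -/
theorem exists_stringQuot_to_cordAlg (m : G) (L : Subgroup G) :
    ∃ f : StringQuot G m L →+* CordAlg G m L, ∀ x, f (stringCl m L x) = cordCl m L x := by
  obtain ⟨g, hg⟩ := exists_unitization_rm_hom (cordCl_mul (m := m) (L := L))
  refine ⟨RingCon.lift _ g (TwoSidedIdeal.ringCon_span_le_ker g ?_), hg⟩
  rintro z ((⟨x, l, hl, rfl⟩ | ⟨x, l, hl, rfl⟩) | ⟨x, rfl⟩) <;>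
    simp only [map_sub, hg, sub_eq_zero]
  · exact cordCl_left x hl
  · exact cordCl_right x hl
  · exact cordCl_comm x

end CordAlg

/-- There is a ring isomorphism from the cord algebra `A_Ng(G,m,L)` to the quotient `Q` of
`R_m(1)` carrying `[x]` to `π([x])`, `μ·1` to `π(𝔢 - 1)` and `μ⁻¹·1` to `π(𝔪̄ - 1)`. -/
theorem cordAlg_equiv_stringQuot (G : Type) [Group G] (m : G) (L : Subgroup G) :
    ∃ f : CordAlg G m L ≃+* StringQuot G m L,
      (∀ x : G, f (cordAlgMap G m L (FreeAlgebra.ι _ x)) = stringQuotMap G m L (br m x)) ∧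
      f (cordAlgMap G m L
          (algebraMap (LaurentPolynomial ℤ) (FreeAlgebra (LaurentPolynomial ℤ) G) (T 1)))
        = stringQuotMap G m L (br m 1 - 1) ∧
      f (cordAlgMap G m L
          (algebraMap (LaurentPolynomial ℤ) (FreeAlgebra (LaurentPolynomial ℤ) G) (T (-1))))
        = stringQuotMap G m L (br m m⁻¹ - 1) := by
  obtain ⟨f, hι, hT₁, hT₂⟩ := exists_cordAlg_to_stringQuot m L
  obtain ⟨g, hg⟩ := exists_stringQuot_to_cordAlg m L
  have hfg : f.comp g = RingHom.id _ := stringQuot_hom_ext fun x => by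
    rw [RingHom.comp_apply, hg, cordCl, hι, RingHom.id_apply]
  have hgf : g.comp f = RingHom.id _ := by
    refine RingCon.Quotient.hom_ext (freeAlgebra_laurent_hom_ext (fun x => ?_) ?_ ?_)
    · exact (congrArg g (hι x)).trans (hg x)
    · refine (congrArg g hT₁).trans ?_
      rw [map_sub, map_one, hg, cordCl_one, add_sub_cancel_left]; rfl
    · refine (congrArg g hT₂).trans ?_
      rw [map_sub, map_one, hg, cordCl_inv, add_sub_cancel_left]; rfl
  refine ⟨RingEquiv.ofRingHom f g hfg hgf, hι, ?_, ?_⟩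
  · rw [map_sub, map_one]; exact hT₁
  · rw [map_sub, map_one]; exact hT₂
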